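/- Let α be a real number with α < −1 or α > 2. Then there exist m_P ≠ m_Q, σ_P ≥ 0, σ_Q ≥ 0 and Borel probability measures P, Q on ℝ (supported on finitely many points) with means m_P, m_Q and variances σ_P², σ_Q² such that D_A^{(α)}(P‖Q) < d_A^{(α)}(r‖s), where r and s are defined from (m_P, σ_P, m_Q, σ_Q) as in the context. Hence the binary α-divergence fails to be a lower bound under the moment constraints for every α outside [−1,2]. -/

import Mathlib

open MeasureTheory Real Set

/-- `v := (1/(2|a|))√((σ_Q²−σ_P²)² + 2a²(σ_P²+σ_Q²) + a⁴)` with `a = m_P − m_Q`. -/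
noncomputable def vParam (mP mQ σP σQ : ℝ) : ℝ :=
  (1 / (2 * |mP - mQ|)) *
    Real.sqrt ((σQ ^ 2 - σP ^ 2) ^ 2 + 2 * (mP - mQ) ^ 2 * (σP ^ 2 + σQ ^ 2) + (mP - mQ) ^ 4)

/-- `r := 1/2 + (σ_Q²−σ_P²+a²)/(4av)`. -/
noncomputable def rParam (mP mQ σP σQ : ℝ) : ℝ :=
  1 / 2 + (σQ ^ 2 - σP ^ 2 + (mP - mQ) ^ 2) / (4 * (mP - mQ) * vParam mP mQ σP σQ)

/-- `s := 1/2 + (σ_Q²−σ_P²−a²)/(4av)`. -/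
noncomputable def sParam (mP mQ σP σQ : ℝ) : ℝ :=
  1 / 2 + (σQ ^ 2 - σP ^ 2 - (mP - mQ) ^ 2) / (4 * (mP - mQ) * vParam mP mQ σP σQ)

/-- The `α`-divergence `D_A^{(α)}(P‖Q)` of Borel probability measures on `ℝ`,
computed with the dominating measure `P + Q` and Radon–Nikodym densities
(the value of the defining integral is invariant in the dominating measure). -/
noncomputable def DA (α : ℝ) (P Q : Measure ℝ) : ℝ :=
  if α = 0 then
    ∫ x, (Q.rnDeriv (P + Q) x).toReal *
      Real.log ((Q.rnDeriv (P + Q) x).toReal / (P.rnDeriv (P + Q) x).toReal) ∂(P + Q)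
  else if α = 1 then
    ∫ x, (P.rnDeriv (P + Q) x).toReal *
      Real.log ((P.rnDeriv (P + Q) x).toReal / (Q.rnDeriv (P + Q) x).toReal) ∂(P + Q)
  else
    (α * (α - 1))⁻¹ *
      ((∫ x, (P.rnDeriv (P + Q) x).toReal ^ α * (Q.rnDeriv (P + Q) x).toReal ^ (1 - α)
        ∂(P + Q)) - 1)

/-- The binary `α`-divergence `d_A^{(α)}(r‖s)`. -/
noncomputable def dA (α r s : ℝ) : ℝ :=
  if α = 0 then s * Real.log (s / r) + (1 - s) * Real.log ((1 - s) / (1 - r))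
  else if α = 1 then r * Real.log (r / s) + (1 - r) * Real.log ((1 - r) / (1 - s))
  else (α * (α - 1))⁻¹ *
    (r ^ α * s ^ (1 - α) + (1 - r) ^ α * (1 - s) ^ (1 - α) - 1)

/-- The measure with mass `w x` at each `x ∈ T`. -/
noncomputable def atomicMeasure (T : Finset ℝ) (w : ℝ → ℝ) : Measure ℝ :=
  ∑ x ∈ T, ENNReal.ofReal (w x) • Measure.dirac x

lemma atomicMeasure_apply (T : Finset ℝ) (w : ℝ → ℝ) {A : Set ℝ} (hA : MeasurableSet A) :
    atomicMeasure T w A = ∑ x ∈ T, ENNReal.ofReal (w x) * A.indicator 1 x := by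
  simp [atomicMeasure, Measure.finsetSum_apply, Measure.dirac_apply' _ hA]

lemma atomicMeasure_compl (T : Finset ℝ) (w : ℝ → ℝ) :
    atomicMeasure T w ((T : Set ℝ))ᶜ = 0 := by
  rw [atomicMeasure_apply T w T.measurableSet.compl]
  refine Finset.sum_eq_zero fun x hx => ?_
  simp [hx]

lemma atomicMeasure_real_singleton {T : Finset ℝ} {w : ℝ → ℝ} {x : ℝ} (hx : x ∈ T)
    (hw : 0 ≤ w x) : (atomicMeasure T w).real {x} = w x := by
  rw [measureReal_def, atomicMeasure_apply T w (measurableSet_singleton x),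
    Finset.sum_eq_single_of_mem x hx]
  · simp [hw]
  · intro y _ hy
    simp [hy]

lemma isProbabilityMeasure_atomicMeasure {T : Finset ℝ} {w : ℝ → ℝ} (hw : ∀ x ∈ T, 0 ≤ w x)
    (h1 : ∑ x ∈ T, w x = 1) : IsProbabilityMeasure (atomicMeasure T w) := by
  constructor
  rw [atomicMeasure_apply T w MeasurableSet.univ]
  simp [← ENNReal.ofReal_sum_of_nonneg hw, h1]

lemma integral_eq_sum_of_compl_eq_zero {μ : Measure ℝ} [IsFiniteMeasure μ] {T : Finset ℝ}
    (hT : μ ((T : Set ℝ))ᶜ = 0) (f : ℝ → ℝ) : ∫ x, f x ∂μ = ∑ x ∈ T, μ.real {x} * f x := by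
  have h : μ.restrict (T : Set ℝ) = μ :=
    Measure.restrict_eq_self_of_ae_mem (mem_ae_iff.2 hT)
  simpa [h] using setIntegral_finset (f := f) (μ := μ) T IntegrableOn.finset

lemma integral_atomicMeasure {T : Finset ℝ} {w : ℝ → ℝ} (hw : ∀ x ∈ T, 0 ≤ w x)
    (h1 : ∑ x ∈ T, w x = 1) (f : ℝ → ℝ) :
    ∫ x, f x ∂(atomicMeasure T w) = ∑ x ∈ T, w x * f x := by
  have := isProbabilityMeasure_atomicMeasure hw h1
  rw [integral_eq_sum_of_compl_eq_zero (atomicMeasure_compl T w)]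
  exact Finset.sum_congr rfl fun x hx => by rw [atomicMeasure_real_singleton hx (hw x hx)]

lemma rnDeriv_toReal_mul_real_singleton {P μ : Measure ℝ} [IsFiniteMeasure P] [IsFiniteMeasure μ]
    (h : P ≪ μ) (x : ℝ) : (P.rnDeriv μ x).toReal * μ.real {x} = P.real {x} := by
  have := Measure.setLIntegral_rnDeriv h {x}
  rw [lintegral_singleton] at this
  rw [measureReal_def, measureReal_def, ← ENNReal.toReal_mul, this]

lemma DA_eq_sum {α : ℝ} (h0 : α ≠ 0) (h1 : α ≠ 1) {P Q : Measure ℝ} [IsFiniteMeasure P]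
    [IsFiniteMeasure Q] {T : Finset ℝ} (hP : P ((T : Set ℝ))ᶜ = 0) (hQ : Q ((T : Set ℝ))ᶜ = 0) :
    DA α P Q =
      (α * (α - 1))⁻¹ * (∑ x ∈ T, P.real {x} ^ α * Q.real {x} ^ (1 - α) - 1) := by
  rw [DA, if_neg h0, if_neg h1,
    integral_eq_sum_of_compl_eq_zero (T := T) (by simp [hP, hQ])]
  congr 2
  refine Finset.sum_congr rfl fun x _ => ?_
  have hp := rnDeriv_toReal_mul_real_singleton (P := P) (μ := P + Q)
    (Measure.AbsolutelyContinuous.rfl.add_right Q) x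
  have hq := rnDeriv_toReal_mul_real_singleton (P := Q) (μ := P + Q)
    (by rw [add_comm]; exact Measure.AbsolutelyContinuous.rfl.add_right P) x
  have hm : 0 ≤ (P + Q).real {x} := measureReal_nonneg
  rw [← hp, ← hq]
  generalize (P + Q).real {x} = m at hm ⊢
  rcases hm.eq_or_lt with h | h
  · rw [← h]
    simp [zero_rpow h0]
  · rw [mul_rpow ENNReal.toReal_nonneg h.le, mul_rpow ENNReal.toReal_nonneg h.le]
    have : m ^ α * m ^ (1 - α) = m := by
      rw [← rpow_add h]
      simp
    linear_combination (- (P.rnDeriv (P + Q) x).toReal ^ α *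
      (Q.rnDeriv (P + Q) x).toReal ^ (1 - α)) * this

lemma DA_swap {α : ℝ} (h0 : α ≠ 0) (h1 : α ≠ 1) (P Q : Measure ℝ) :
    DA α P Q = DA (1 - α) Q P := by
  rw [DA, DA, if_neg h0, if_neg h1, if_neg (sub_ne_zero.2 h1.symm),
    if_neg (by simpa using h0), add_comm Q P, sub_sub_cancel]
  simp_rw [mul_comm (_ ^ (1 - α)) (_ ^ α)]
  congr 2
  ring

lemma dA_swap {α : ℝ} (h0 : α ≠ 0) (h1 : α ≠ 1) (r s : ℝ) : dA α r s = dA (1 - α) s r := by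
  rw [dA, dA, if_neg h0, if_neg h1, if_neg (sub_ne_zero.2 h1.symm),
    if_neg (by simpa using h0), sub_sub_cancel]
  rw [mul_comm (r ^ α), mul_comm ((1 - r) ^ α)]
  congr 2
  ring

lemma vParam_swap (mP mQ σP σQ : ℝ) : vParam mP mQ σP σQ = vParam mQ mP σQ σP := by
  rw [vParam, vParam, abs_sub_comm]
  congr 2
  ring

lemma rParam_swap (mP mQ σP σQ : ℝ) : rParam mP mQ σP σQ = sParam mQ mP σQ σP := by
  rw [rParam, sParam, vParam_swap, ← neg_sub mQ mP, mul_neg, neg_mul, div_neg, ← neg_div]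
  congr 2
  ring

lemma sParam_swap (mP mQ σP σQ : ℝ) : sParam mP mQ σP σQ = rParam mQ mP σQ σP :=
  (rParam_swap mQ mP σQ σP).symm

lemma mul_vParam_sq {mP mQ : ℝ} (h : mP ≠ mQ) (σP σQ : ℝ) :
    4 * (mP - mQ) ^ 2 * vParam mP mQ σP σQ ^ 2 =
      (σQ ^ 2 - σP ^ 2) ^ 2 + 2 * (mP - mQ) ^ 2 * (σP ^ 2 + σQ ^ 2) + (mP - mQ) ^ 4 := by
  have ha : (mP - mQ) ≠ 0 := sub_ne_zero.2 h
  rw [vParam, mul_pow, div_pow, mul_pow, sq_abs, sq_sqrt (by positivity)]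
  field_simp
  ring

lemma vParam_pos {mP mQ : ℝ} (h : mP ≠ mQ) (σP σQ : ℝ) : 0 < vParam mP mQ σP σQ := by
  have ha : (mP - mQ) ≠ 0 := sub_ne_zero.2 h
  have : 0 < (mP - mQ) ^ 4 := by positivity
  rw [vParam]
  positivity

lemma rParam_mul_one_sub {mP mQ : ℝ} (h : mP ≠ mQ) (σP σQ : ℝ) :
    rParam mP mQ σP σQ * (1 - rParam mP mQ σP σQ) = σP ^ 2 / (4 * vParam mP mQ σP σQ ^ 2) := by
  have ha : (mP - mQ) ≠ 0 := sub_ne_zero.2 h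
  have hv := (vParam_pos h σP σQ).ne'
  have := mul_vParam_sq h σP σQ
  rw [rParam]
  field_simp
  linear_combination 4 * this

lemma sParam_mul_one_sub {mP mQ : ℝ} (h : mP ≠ mQ) (σP σQ : ℝ) :
    sParam mP mQ σP σQ * (1 - sParam mP mQ σP σQ) = σQ ^ 2 / (4 * vParam mP mQ σP σQ ^ 2) := by
  rw [sParam_swap, rParam_mul_one_sub h.symm, vParam_swap]

/-- Lower bound on the two-point power sum when `P` has much larger variance than `Q`. -/
lemma le_binary_rpow_sum {mP mQ σP σQ u α : ℝ} (hα : 2 < α) (hu : 10 ≤ u)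
    (ha : 1 / 2 ≤ mP - mQ) (ha' : mP - mQ ≤ 1) (hP : u / 2 ≤ σP ^ 2) (hP' : σP ^ 2 ≤ u)
    (hQ : 0 < σQ ^ 2) (hQ' : σQ ^ 2 ≤ 2) :
    1 / (16 * u) * (u / 8) ^ (α - 1) ≤
      rParam mP mQ σP σQ ^ α * sParam mP mQ σP σQ ^ (1 - α) +
        (1 - rParam mP mQ σP σQ) ^ α * (1 - sParam mP mQ σP σQ) ^ (1 - α) := by
  have hne : mP ≠ mQ := by
    intro h
    rw [h] at ha
    norm_num at ha
  have hv := vParam_pos hne σP σQ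
  have hr := rParam_mul_one_sub hne σP σQ
  have hs := sParam_mul_one_sub hne σP σQ
  have hv2 := mul_vParam_sq hne σP σQ
  have hs2 : sParam mP mQ σP σQ ≤ 1 / 2 := by
    rw [sParam, add_le_iff_nonpos_right]
    apply div_nonpos_of_nonpos_of_nonneg
    · nlinarith [sq_nonneg (mP - mQ)]
    · have : 0 ≤ mP - mQ := by linarith
      positivity
  set r := rParam mP mQ σP σQ
  set s := sParam mP mQ σP σQ
  set v := vParam mP mQ σP σQ
  set a := mP - mQ
  have hvu : 4 * v ^ 2 ≤ 8 * u ^ 2 := by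
    have h1 : (1 / 2) ^ 2 ≤ a ^ 2 := by gcongr
    have h2 : a ^ 2 ≤ 1 := by nlinarith
    have h3 : a ^ 4 ≤ 1 := by nlinarith [sq_nonneg a]
    have h4 : (σQ ^ 2 - σP ^ 2) ^ 2 ≤ u ^ 2 := by nlinarith
    have h5 : a ^ 2 * (σP ^ 2 + σQ ^ 2) ≤ 1 * (u + 2) := by gcongr
    have h6 : v ^ 2 ≤ 4 * a ^ 2 * v ^ 2 := by nlinarith [sq_nonneg v]
    nlinarith
  have hr0 : 0 < r * (1 - r) := by
    rw [hr]
    have : 0 < σP ^ 2 := by linarith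
    positivity
  have hs0 : 0 < s * (1 - s) := by rw [hs]; positivity
  have hrpos : 0 < r := by nlinarith
  have hr1 : 0 < 1 - r := by nlinarith
  have hspos : 0 < s := by nlinarith
  have hs1 : 0 < 1 - s := by nlinarith
  have hrlow : σP ^ 2 / (4 * v ^ 2) ≤ r := by nlinarith
  have hrlow' : 1 / (16 * u) ≤ r := by
    refine le_trans ?_ hrlow
    calc 1 / (16 * u) = (u / 2) / (8 * u ^ 2) := by field_simp; norm_num
      _ ≤ _ := by gcongr
  have hsup : s ≤ 2 * (σQ ^ 2 / (4 * v ^ 2)) := by nlinarith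
  have hratio : u / 8 ≤ r / s := by
    rw [le_div_iff₀ hspos]
    calc u / 8 * s ≤ u / 8 * (2 * (2 / (4 * v ^ 2))) := by
          gcongr
          exact hsup.trans (by gcongr)
      _ = (u / 2) / (4 * v ^ 2) := by ring
      _ ≤ σP ^ 2 / (4 * v ^ 2) := by gcongr
      _ ≤ r := hrlow
  have hrs : r ^ α * s ^ (1 - α) = r * (r / s) ^ (α - 1) := by
    rw [div_rpow hrpos.le hspos.le, rpow_sub_one hrpos.ne', ← neg_sub α 1, rpow_neg hspos.le]
    field_simp
  calc _ ≤ r * (r / s) ^ (α - 1) := by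
        gcongr
        linarith
    _ = r ^ α * s ^ (1 - α) := hrs.symm
    _ ≤ _ := le_add_of_nonneg_right (by positivity)

lemma exists_large_scale {α : ℝ} (hα : 2 < α) :
    ∃ u : ℝ, 10 ≤ u ∧
      2 ^ (α - 1) + (u⁻¹ ^ 3) ^ α * (u⁻¹ ^ 4) ^ (1 - α) < 1 / (16 * u) * (u / 8) ^ (α - 1) := by
  have h1 := (tendsto_rpow_atTop (show 0 < α - 2 by linarith)).eventually_gt_atTop
    (32 * 8 ^ (α - 1) * 2 ^ (α - 1))
  have h2 := (Filter.tendsto_pow_atTop (α := ℝ) two_ne_zero).eventually_gt_atTop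
    (32 * 8 ^ (α - 1))
  obtain ⟨u, hu1, hu2, hu⟩ := (h1.and (h2.and (Filter.eventually_ge_atTop (10 : ℝ)))).exists
  refine ⟨u, hu, ?_⟩
  have hu0 : 0 < u := by linarith
  have e1 : (u⁻¹ ^ 3) ^ α * (u⁻¹ ^ 4) ^ (1 - α) = u ^ (α - 2) / u ^ 2 := by
    have h3 : u⁻¹ ^ 3 = u ^ (-3 : ℝ) := by rw [rpow_neg hu0.le]; norm_cast; simp
    have h4 : u⁻¹ ^ 4 = u ^ (-4 : ℝ) := by rw [rpow_neg hu0.le]; norm_cast; simp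
    rw [h3, h4, ← rpow_mul hu0.le, ← rpow_mul hu0.le, ← rpow_add hu0, ← rpow_natCast u 2,
      ← rpow_sub hu0]
    congr 1
    push_cast
    ring
  have e2 : 1 / (16 * u) * (u / 8) ^ (α - 1) = u ^ (α - 2) / (16 * 8 ^ (α - 1)) := by
    rw [div_rpow hu0.le (by norm_num), show α - 1 = α - 2 + 1 by ring, rpow_add_one hu0.ne']
    field_simp
  rw [e1, e2]
  have h8 : (0 : ℝ) < 8 ^ (α - 1) := by positivity
  have hU : 0 < u ^ (α - 2) := by positivity
  have b1 : (2 : ℝ) ^ (α - 1) < u ^ (α - 2) / (32 * 8 ^ (α - 1)) := by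
    rw [lt_div_iff₀ (by positivity)]
    linarith
  have b2 : u ^ (α - 2) / u ^ 2 < u ^ (α - 2) / (32 * 8 ^ (α - 1)) := by gcongr
  calc _ < u ^ (α - 2) / (32 * 8 ^ (α - 1)) + u ^ (α - 2) / (32 * 8 ^ (α - 1)) := add_lt_add b1 b2
    _ = _ := by field_simp; norm_num

lemma exists_DA_lt_dA_of_two_lt {α : ℝ} (hα : 2 < α) :
    ∃ (mP mQ σP σQ : ℝ) (P Q : Measure ℝ),
      mP ≠ mQ ∧ 0 ≤ σP ∧ 0 ≤ σQ ∧
      IsProbabilityMeasure P ∧ IsProbabilityMeasure Q ∧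
      (∃ T : Finset ℝ, P ((T : Set ℝ))ᶜ = 0 ∧ Q ((T : Set ℝ))ᶜ = 0) ∧
      ∫ x, x ∂P = mP ∧ ∫ x, x ∂Q = mQ ∧
      ∫ x, (x - mP) ^ 2 ∂P = σP ^ 2 ∧ ∫ x, (x - mQ) ^ 2 ∂Q = σQ ^ 2 ∧
      DA α P Q < dA α (rParam mP mQ σP σQ) (sParam mP mQ σP σQ) := by
  obtain ⟨u, hu, hlt⟩ := exists_large_scale hα
  have hu0 : 0 < u := by linarith
  set w := u⁻¹ with hw
  have hwu : w * u = 1 := inv_mul_cancel₀ hu0.ne'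
  have hw0 : 0 < w := by positivity
  have hw1 : w ≤ 1 / 10 := by nlinarith
  have hw2 : w ^ 2 ≤ w / 10 := by nlinarith
  have hw3 : w ^ 3 ≤ 1 / 1000 := (pow_le_pow_left₀ hw0.le hw1 3).trans (by norm_num)
  have hw4 : w ^ 4 ≤ w ^ 2 / 100 := by nlinarith [sq_nonneg w]
  have hw2' : 0 < w ^ 2 := by positivity
  have hw4' : 0 < w ^ 4 := by positivity
  have hN : 0 < u ^ 2 := by positivity
  have hN1 : u ^ 2 ≠ -1 := by linarith
  let T : Finset ℝ := {0, -1, u ^ 2}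
  let p : ℝ → ℝ := fun x => if x = 0 then 1 - w ^ 3 else if x = -1 then 0 else w ^ 3
  let q : ℝ → ℝ := fun x => if x = 0 then 1 / 2 else if x = -1 then 1 / 2 - w ^ 4 else w ^ 4
  have hsum (f : ℝ → ℝ) : ∑ x ∈ T, f x = f 0 + f (-1) + f (u ^ 2) := by
    rw [Finset.sum_insert, Finset.sum_pair hN1.symm, add_assoc]
    simp [hN.ne]
  have p0 : p 0 = 1 - w ^ 3 := by simp [p]
  have p1 : p (-1) = 0 := by simp [p]
  have pN : p (u ^ 2) = w ^ 3 := by simp [p, hu0.ne', hN1]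
  have q0 : q 0 = 1 / 2 := by simp [q]
  have q1 : q (-1) = 1 / 2 - w ^ 4 := by simp [q]
  have qN : q (u ^ 2) = w ^ 4 := by simp [q, hu0.ne', hN1]
  have hp : ∀ x ∈ T, 0 ≤ p x := by
    intro x _
    dsimp only [p]
    split_ifs
    · linarith
    · exact le_rfl
    · positivity
  have hq : ∀ x ∈ T, 0 ≤ q x := by
    intro x _
    dsimp only [q]
    split_ifs <;> linarith
  have hp1 : ∑ x ∈ T, p x = 1 := by rw [hsum, p0, p1, pN]; ring
  have hq1 : ∑ x ∈ T, q x = 1 := by rw [hsum, q0, q1, qN]; ring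
  have iP := isProbabilityMeasure_atomicMeasure hp hp1
  have iQ := isProbabilityMeasure_atomicMeasure hq hq1
  have hvarP : 0 ≤ u - w ^ 2 := by linarith
  have hvarQ : 0 < 3 / 2 - w ^ 4 - (-1 / 2 + w ^ 2 + w ^ 4) ^ 2 := by nlinarith
  refine ⟨w, -1 / 2 + w ^ 2 + w ^ 4, √(u - w ^ 2),
    √(3 / 2 - w ^ 4 - (-1 / 2 + w ^ 2 + w ^ 4) ^ 2), atomicMeasure T p, atomicMeasure T q,
    by linarith, sqrt_nonneg _, sqrt_nonneg _, iP, iQ,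
    ⟨T, atomicMeasure_compl T p, atomicMeasure_compl T q⟩, ?_, ?_, ?_, ?_, ?_⟩
  · rw [integral_atomicMeasure hp hp1, hsum, p0, p1, pN]
    linear_combination w * (w * u + 1) * hwu
  · rw [integral_atomicMeasure hq hq1, hsum, q0, q1, qN]
    linear_combination w ^ 2 * (w * u + 1) * hwu
  · rw [sq_sqrt hvarP, integral_atomicMeasure hp hp1, hsum, p0, p1, pN]
    linear_combination (u * (w ^ 2 * u ^ 2 + w * u + 1) - 2 * w ^ 2 * (w * u + 1)) * hwu
  · rw [sq_sqrt hvarQ.le, integral_atomicMeasure hq hq1, hsum, q0, q1, qN]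
    linear_combination ((w * u + 1) * (w ^ 2 * u ^ 2 + 1) -
      2 * (-1 / 2 + w ^ 2 + w ^ 4) * w ^ 2 * (w * u + 1)) * hwu
  · have hlow := le_binary_rpow_sum (mP := w) (mQ := -1 / 2 + w ^ 2 + w ^ 4) (σP := √(u - w ^ 2))
      (σQ := √(3 / 2 - w ^ 4 - (-1 / 2 + w ^ 2 + w ^ 4) ^ 2)) hα hu (by linarith) (by linarith)
      (by rw [sq_sqrt hvarP]; linarith) (by rw [sq_sqrt hvarP]; linarith)
      (by rwa [sq_sqrt hvarQ.le]) (by rw [sq_sqrt hvarQ.le]; nlinarith)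
    have hupp : ∑ x ∈ T, (atomicMeasure T p).real {x} ^ α * (atomicMeasure T q).real {x} ^ (1 - α)
        ≤ 2 ^ (α - 1) + (w ^ 3) ^ α * (w ^ 4) ^ (1 - α) := by
      have : ∑ x ∈ T, (atomicMeasure T p).real {x} ^ α * (atomicMeasure T q).real {x} ^ (1 - α)
          = ∑ x ∈ T, p x ^ α * q x ^ (1 - α) := Finset.sum_congr rfl fun x hx => by
        rw [atomicMeasure_real_singleton hx (hp x hx), atomicMeasure_real_singleton hx (hq x hx)]
      rw [this, hsum, p0, p1, pN, q0, q1, qN, zero_rpow (by linarith), zero_mul, add_zero,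
        one_div, inv_rpow zero_le_two, ← rpow_neg zero_le_two, neg_sub]
      gcongr
      refine mul_le_of_le_one_left (by positivity) (rpow_le_one ?_ ?_ ?_)
      · linarith
      · linarith [pow_pos hw0 3]
      · linarith
    rw [DA_eq_sum (by linarith) (by linarith) (atomicMeasure_compl T p) (atomicMeasure_compl T q),
      dA, if_neg (by linarith), if_neg (by linarith)]
    have hpos : 0 < (α * (α - 1))⁻¹ := inv_pos.2 (mul_pos (by linarith) (by linarith))
    exact mul_lt_mul_of_pos_left (by linarith) hpos

/-- Necessary condition in Theorem 2 (a): for every `α` with `α < -1` or `α > 2`,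
the binary `α`-divergence fails to be a lower bound under the moment
constraints: there exist `m_P ≠ m_Q`, `σ_P, σ_Q ≥ 0` and finitely supported
Borel probability measures `P, Q` on `ℝ` with these means and variances such
that `D_A^{(α)}(P‖Q) < d_A^{(α)}(r‖s)`. -/
theorem binary_alpha_div_not_lower_bound
    (α : ℝ) (hα : α < -1 ∨ 2 < α) :
    ∃ (mP mQ σP σQ : ℝ) (P Q : Measure ℝ),
      mP ≠ mQ ∧ 0 ≤ σP ∧ 0 ≤ σQ ∧
      IsProbabilityMeasure P ∧ IsProbabilityMeasure Q ∧
      (∃ T : Finset ℝ, P ((T : Set ℝ))ᶜ = 0 ∧ Q ((T : Set ℝ))ᶜ = 0) ∧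
      ∫ x, x ∂P = mP ∧ ∫ x, x ∂Q = mQ ∧
      ∫ x, (x - mP) ^ 2 ∂P = σP ^ 2 ∧ ∫ x, (x - mQ) ^ 2 ∂Q = σQ ^ 2 ∧
      DA α P Q < dA α (rParam mP mQ σP σQ) (sParam mP mQ σP σQ) := by
  rcases hα with hα | hα
  · obtain ⟨mP, mQ, σP, σQ, P, Q, hm, hσP, hσQ, iP, iQ, ⟨T, hTP, hTQ⟩, hmP, hmQ, hvP, hvQ, h⟩ :=
      exists_DA_lt_dA_of_two_lt (α := 1 - α) (by linarith)
    refine ⟨mQ, mP, σQ, σP, Q, P, hm.symm, hσQ, hσP, iQ, iP, ⟨T, hTQ, hTP⟩, hmQ, hmP, hvQ, hvP, ?_⟩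
    have h0 : α ≠ 0 := by linarith
    have h1 : α ≠ 1 := by linarith
    rwa [DA_swap h0 h1, dA_swap h0 h1, rParam_swap, sParam_swap]
  · exact exists_DA_lt_dA_of_two_lt hα
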